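/- Let n ≥ 2, let γ : ℝ → ℝ be continuous, and define f(t) = exp( −2 ∫₀ᵗ γ(s) ds ) and T(t) = 1 − 2^{1−n} + max{ 1 − 2^{1−n}, f(t) } (the trace-norm total correlation of the n-qubit GHZ state evolved under local dephasing with total rate γ). Then: (i) at every t with f(t) > 1 − 2^{1−n}, T is differentiable with T′(t) = −2 γ(t) f(t); (ii) at every t with f(t) < 1 − 2^{1−n}, T is differentiable with T′(t) = 0; and (iii) at any t satisfying f(t) ≠ 1 − 2^{1−n}, one has T′(t) > 0 if and only if γ(t) < 0 and f(t) > 1 − 2^{1−n}. In particular, if γ(s) ≥ 0 for all s ≥ 0, then T is nonincreasing on [0, ∞). -/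

import Mathlib

open Matrix ComplexOrder Kronecker


theorem hasDerivAt_exp_neg_two_mul_integral {γ : ℝ → ℝ} (hγ : Continuous γ) (t : ℝ) :
    HasDerivAt (fun t => Real.exp (-2 * ∫ s in (0 : ℝ)..t, γ s))
      (-2 * γ t * Real.exp (-2 * ∫ s in (0 : ℝ)..t, γ s)) t := by
  have h := ((hγ.integral_hasStrictDerivAt 0 t).hasDerivAt.const_mul (-2)).exp
  rwa [mul_comm] at h

theorem antitoneOn_exp_neg_two_mul_integral {γ : ℝ → ℝ} (hγ : Continuous γ)
    (h0 : ∀ s, 0 ≤ s → 0 ≤ γ s) :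
    AntitoneOn (fun t => Real.exp (-2 * ∫ s in (0 : ℝ)..t, γ s)) (Set.Ici 0) := by
  intro a ha b _ hab
  have hadd := intervalIntegral.integral_add_adjacent_intervals
    (hγ.intervalIntegrable (μ := MeasureTheory.volume) 0 a) (hγ.intervalIntegrable a b)
  have hnonneg : 0 ≤ ∫ s in a..b, γ s :=
    intervalIntegral.integral_nonneg hab fun s hs => h0 s (le_trans ha hs.1)
  exact Real.exp_le_exp.mpr (by linarith)

/-- For `γ` continuous, `f(t) = exp(−2∫₀ᵗ γ)` and
`T(t) = 1 − 2^{1−n} + max{1 − 2^{1−n}, f(t)}`: (i) where `f > 1 − 2^{1−n}`, `T` has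
derivative `−2 γ f`; (ii) where `f < 1 − 2^{1−n}`, `T` has derivative `0`;
(iii) where `f ≠ 1 − 2^{1−n}`, `T′ > 0` iff `γ < 0` and `f > 1 − 2^{1−n}`; and if
`γ ≥ 0` on `[0, ∞)` then `T` is nonincreasing on `[0, ∞)`. -/
theorem dephasing_total_correlation_derivative (n : ℕ) (hn : 2 ≤ n)
    (γ : ℝ → ℝ) (hγ : Continuous γ) (f T : ℝ → ℝ)
    (hf : ∀ t, f t = Real.exp (-2 * ∫ s in (0 : ℝ)..t, γ s))
    (hT : ∀ t, T t = 1 - 2 / 2 ^ n + max (1 - 2 / 2 ^ n) (f t)) :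
    (∀ t, 1 - 2 / 2 ^ n < f t → HasDerivAt T (-2 * γ t * f t) t) ∧
    (∀ t, f t < 1 - 2 / 2 ^ n → HasDerivAt T 0 t) ∧
    (∀ t, f t ≠ 1 - 2 / 2 ^ n →
      (0 < deriv T t ↔ γ t < 0 ∧ 1 - 2 / 2 ^ n < f t)) ∧
    ((∀ s, 0 ≤ s → 0 ≤ γ s) → AntitoneOn T (Set.Ici (0 : ℝ))) := by
  obtain rfl : f = fun t => Real.exp (-2 * ∫ s in (0 : ℝ)..t, γ s) := funext hf
  obtain rfl := funext hT
  set f := fun t => Real.exp (-2 * ∫ s in (0 : ℝ)..t, γ s)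
  have hderiv : ∀ t, HasDerivAt f (-2 * γ t * f t) t := hasDerivAt_exp_neg_two_mul_integral hγ
  have hcont : Continuous f := continuous_iff_continuousAt.mpr fun t => (hderiv t).continuousAt
  set c : ℝ := 1 - 2 / 2 ^ n
  have habove : ∀ t, c < f t → HasDerivAt (fun t => c + max c (f t)) (-2 * γ t * f t) t := by
    intro t ht
    refine ((hderiv t).const_add c).congr_of_eventuallyEq ?_
    filter_upwards [hcont.continuousAt.eventually_const_lt ht] with x hx
    rw [max_eq_right hx.le]
  have hbelow : ∀ t, f t < c → HasDerivAt (fun t => c + max c (f t)) 0 t := by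
    intro t ht
    refine (hasDerivAt_const t (c + c)).congr_of_eventuallyEq ?_
    filter_upwards [hcont.continuousAt.eventually_lt_const ht] with x hx
    rw [max_eq_left hx.le]
  refine ⟨habove, hbelow, fun t hne => ?_, fun h0 a ha b hb hab => ?_⟩
  · rcases hne.lt_or_gt with h | h
    · rw [(hbelow t h).deriv]
      exact ⟨fun h' => absurd h' (lt_irrefl 0), fun h' => absurd h'.2 h.not_gt⟩
    · rw [(habove t h).deriv, mul_pos_iff_of_pos_right (Real.exp_pos _)]
      constructor
      · exact fun h' => ⟨by linarith, h⟩
      · exact fun h' => by linarith [h'.1]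
  · have hfab : f b ≤ f a := antitoneOn_exp_neg_two_mul_integral hγ h0 ha hb hab
    dsimp only
    gcongr
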